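/- arXiv:solv-int/9805005 — 2 statements merged into one kernel-verified Lean document; each statement's English description precedes it below -/
import Mathlib

section
/- Let β_ij satisfy the Darboux equations on a nonempty open connected U ⊆ ℝ^N. Let ξ_{i,(1)} : U → ℝ^{M₁} and ξ_{i,(2)} : U → ℝ^{M₂} be X-solutions for β and ξ*_{i,(1)}, ξ*_{i,(2)} H-solutions for β (row vectors of lengths M₁, M₂). Let Ω_{ab} := Ω(ξ_{(a)},ξ*_{(b)}) (a,b ∈ {1,2}) be potentials, with Ω_{22} invertible everywhere on U. Define ξ'_{i,(1)} := ξ_{i,(1)} − Ω_{12} Ω_{22}⁻¹ ξ_{i,(2)} and ξ'^*_{i,(1)} := ξ*_{i,(1)} − ξ*_{i,(2)} Ω_{22}⁻¹ Ω_{21}. Then the Schur complement Ω' := Ω_{11} − Ω_{12} Ω_{22}⁻¹ Ω_{21} satisfies ∂_i Ω' = ξ'_{i,(1)} ξ'^*_{i,(1)} (outer product) for every i; i.e. Ω' is a potential for the once-transformed data (ξ'_{(1)}, ξ'^*_{(1)}). -/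
open Matrix Finset

/-- Partial derivative of a scalar function on `ℝ^N` in the `i`-th coordinate direction. -/
noncomputable def pd {N : ℕ} (i : Fin N) (f : (Fin N → ℝ) → ℝ) (u : Fin N → ℝ) : ℝ :=
  fderiv ℝ f u (Pi.single i 1)

/-- A matrix-valued function has all entries differentiable at `u`, and `A'` is the matrix of their
partial derivatives in the `i`-th coordinate direction. -/
def HasMatrixPd {N : ℕ} {m n : Type*} (i : Fin N) (A : (Fin N → ℝ) → Matrix m n ℝ)
    (A' : Matrix m n ℝ) (u : Fin N → ℝ) : Prop :=
  ∀ a b, DifferentiableAt ℝ (fun v => A v a b) u ∧ pd i (fun v => A v a b) u = A' a b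

namespace HasMatrixPd

variable {N : ℕ} {l m n : Type*} {i : Fin N} {u : Fin N → ℝ}

theorem sub {A B : (Fin N → ℝ) → Matrix m n ℝ} {A' B' : Matrix m n ℝ}
    (hA : HasMatrixPd i A A' u) (hB : HasMatrixPd i B B' u) :
    HasMatrixPd i (fun v => A v - B v) (A' - B') u := by
  intro a b
  refine ⟨(hA a b).1.sub (hB a b).1, ?_⟩
  have h := ((hA a b).1.hasFDerivAt.sub (hB a b).1.hasFDerivAt).fderiv
  have e : (fun v => (A v - B v) a b) = (fun v => A v a b) - (fun v => B v a b) := rfl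
  rw [pd, e, h, Matrix.sub_apply, ← (hA a b).2, ← (hB a b).2]
  rfl

theorem mul [Fintype m] {A : (Fin N → ℝ) → Matrix l m ℝ} {B : (Fin N → ℝ) → Matrix m n ℝ}
    {A' : Matrix l m ℝ} {B' : Matrix m n ℝ}
    (hA : HasMatrixPd i A A' u) (hB : HasMatrixPd i B B' u) :
    HasMatrixPd i (fun v => A v * B v) (A' * B u + A u * B') u := by
  intro a b
  have h : HasFDerivAt (fun v => (A v * B v) a b) _ u :=
    HasFDerivAt.fun_sum (u := Finset.univ) fun c _ =>
      (hA a c).1.hasFDerivAt.mul (hB c b).1.hasFDerivAt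
  refine ⟨h.differentiableAt, ?_⟩
  rw [pd, h.fderiv, Matrix.add_apply, Matrix.mul_apply, Matrix.mul_apply, ← Finset.sum_add_distrib,
    _root_.sum_apply]
  refine Finset.sum_congr rfl fun c _ => ?_
  rw [← (hA a c).2, ← (hB c b).2]
  simp only [pd, _root_.add_apply, _root_.smul_apply, smul_eq_mul]
  ring

end HasMatrixPd

theorem differentiableAt_matrix_det {E n : Type*} [NormedAddCommGroup E] [NormedSpace ℝ E]
    [Fintype n] [DecidableEq n] {A : E → Matrix n n ℝ} {u : E}
    (hA : ∀ a b, DifferentiableAt ℝ (fun v => A v a b) u) :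
    DifferentiableAt ℝ (fun v => (A v).det) u := by
  simp only [Matrix.det_apply']
  exact DifferentiableAt.fun_sum fun σ _ =>
    (HasFDerivAt.finsetProd fun c _ => (hA (σ c) c).hasFDerivAt).differentiableAt.const_mul _

theorem differentiableAt_matrix_inv {E n : Type*} [NormedAddCommGroup E] [NormedSpace ℝ E]
    [Fintype n] [DecidableEq n] {A : E → Matrix n n ℝ} {u : E}
    (hA : ∀ a b, DifferentiableAt ℝ (fun v => A v a b) u) (hu : IsUnit (A u).det) (a b : n) :
    DifferentiableAt ℝ (fun v => (A v)⁻¹ a b) u := by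
  simp only [Matrix.inv_def, Matrix.smul_apply, Ring.inverse_eq_inv', smul_eq_mul,
    Matrix.adjugate_apply]
  refine ((differentiableAt_matrix_det hA).inv hu.ne_zero).mul
    (differentiableAt_matrix_det fun c d => ?_)
  by_cases h : c = b
  · subst h
    simp only [Matrix.updateRow_self]
    exact differentiableAt_const _
  · simpa only [Matrix.updateRow_ne h] using hA c d

theorem HasMatrixPd.inv {N : ℕ} {n : Type*} [Fintype n] [DecidableEq n] {i : Fin N}
    {u : Fin N → ℝ} {A : (Fin N → ℝ) → Matrix n n ℝ} {A' : Matrix n n ℝ}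
    (hA : HasMatrixPd i A A' u) (hu : IsUnit (A u).det) :
    HasMatrixPd i (fun v => (A v)⁻¹) (-((A u)⁻¹ * A' * (A u)⁻¹)) u := by
  have hdiff := differentiableAt_matrix_inv (fun a b => (hA a b).1) hu
  have hX : HasMatrixPd i (fun v => (A v)⁻¹)
      (Matrix.of fun a b => pd i (fun v => (A v)⁻¹ a b) u) u := fun a b => ⟨hdiff a b, rfl⟩
  have hone : ∀ᶠ v in nhds u, A v * (A v)⁻¹ = 1 := by
    filter_upwards [(differentiableAt_matrix_det fun a b => (hA a b).1).continuousAt.eventually_ne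
      hu.ne_zero] with v hv
    exact Matrix.mul_nonsing_inv _ (isUnit_iff_ne_zero.mpr hv)
  have hzero : A' * (A u)⁻¹ + A u * (Matrix.of fun a b => pd i (fun v => (A v)⁻¹ a b) u) = 0 := by
    ext a b
    have hconst : (fun v => (A v * (A v)⁻¹) a b) =ᶠ[nhds u] fun _ => (1 : Matrix n n ℝ) a b :=
      hone.mono fun v hv => congrFun (congrFun hv a) b
    rw [← ((hA.mul hX) a b).2, pd, hconst.fderiv_eq]
    simp
  have hval : (Matrix.of fun a b => pd i (fun v => (A v)⁻¹ a b) u)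
      = -((A u)⁻¹ * A' * (A u)⁻¹) := by
    rw [← Matrix.nonsing_inv_mul_cancel_left (A := A u)
      (B := Matrix.of fun a b => pd i (fun v => (A v)⁻¹ a b) u) hu,
      eq_neg_of_add_eq_zero_right hzero, Matrix.mul_neg, Matrix.mul_assoc]
  exact hval ▸ hX

/-- If the blocks of a matrix have rank-one derivatives, so does their Schur complement. -/
theorem schur_vecMulVec {m n : Type*} [Fintype m] [Fintype n]
    (x₁ y₁ : m → ℝ) (x₂ y₂ : n → ℝ) (B : Matrix m n ℝ) (W : Matrix n n ℝ) (C : Matrix n m ℝ) :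
    vecMulVec x₁ y₁ - ((vecMulVec x₁ y₂ * W + B * -(W * vecMulVec x₂ y₂ * W)) * C
      + B * W * vecMulVec x₂ y₁)
      = vecMulVec (x₁ - (B * W) *ᵥ x₂) (y₁ - y₂ ᵥ* (W * C)) := by
  simp only [sub_vecMulVec, vecMulVec_sub, ← mul_vecMulVec, ← vecMulVec_mul, Matrix.mul_assoc,
    Matrix.mul_neg, Matrix.neg_mul, Matrix.add_mul, Matrix.sub_mul]
  abel

/-- The Schur complement `Ω' := Ω₁₁ − Ω₁₂ Ω₂₂⁻¹ Ω₂₁` is a potential for the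
once-transformed data `ξ'_{(1)}, ξ'^*_{(1)}`. -/
theorem stmt_9 {N M₁ M₂ : ℕ} (hN : 2 ≤ N)
    (U : Set (Fin N → ℝ)) (hUopen : IsOpen U) (hUconn : IsConnected U)
    (β : Fin N → Fin N → (Fin N → ℝ) → ℝ)
    (hβsmooth : ∀ i j : Fin N, i ≠ j → ContDiffOn ℝ (⊤ : ℕ∞) (β i j) U)
    (hDarboux : ∀ i j k : Fin N, i ≠ j → j ≠ k → i ≠ k → ∀ u ∈ U,
      pd k (β i j) u = β i k u * β k j u)
    (ξ₁ : Fin N → (Fin N → ℝ) → Fin M₁ → ℝ)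
    (hξ₁smooth : ∀ (j : Fin N) (a : Fin M₁), ContDiffOn ℝ (⊤ : ℕ∞) (fun u => ξ₁ j u a) U)
    (hξ₁X : ∀ i j : Fin N, i ≠ j → ∀ u ∈ U, ∀ a : Fin M₁,
      pd i (fun v => ξ₁ j v a) u = β j i u * ξ₁ i u a)
    (ξ₂ : Fin N → (Fin N → ℝ) → Fin M₂ → ℝ)
    (hξ₂smooth : ∀ (j : Fin N) (a : Fin M₂), ContDiffOn ℝ (⊤ : ℕ∞) (fun u => ξ₂ j u a) U)
    (hξ₂X : ∀ i j : Fin N, i ≠ j → ∀ u ∈ U, ∀ a : Fin M₂,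
      pd i (fun v => ξ₂ j v a) u = β j i u * ξ₂ i u a)
    (ξs₁ : Fin N → (Fin N → ℝ) → Fin M₁ → ℝ)
    (hξs₁smooth : ∀ (j : Fin N) (b : Fin M₁), ContDiffOn ℝ (⊤ : ℕ∞) (fun u => ξs₁ j u b) U)
    (hξs₁H : ∀ i j : Fin N, i ≠ j → ∀ u ∈ U, ∀ b : Fin M₁,
      pd i (fun v => ξs₁ j v b) u = β i j u * ξs₁ i u b)
    (ξs₂ : Fin N → (Fin N → ℝ) → Fin M₂ → ℝ)
    (hξs₂smooth : ∀ (j : Fin N) (b : Fin M₂), ContDiffOn ℝ (⊤ : ℕ∞) (fun u => ξs₂ j u b) U)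
    (hξs₂H : ∀ i j : Fin N, i ≠ j → ∀ u ∈ U, ∀ b : Fin M₂,
      pd i (fun v => ξs₂ j v b) u = β i j u * ξs₂ i u b)
    (Ω₁₁ : (Fin N → ℝ) → Matrix (Fin M₁) (Fin M₁) ℝ)
    (hΩ₁₁smooth : ∀ (a b : Fin M₁), ContDiffOn ℝ (⊤ : ℕ∞) (fun u => Ω₁₁ u a b) U)
    (hΩ₁₁ : ∀ i : Fin N, ∀ u ∈ U, ∀ (a b : Fin M₁),
      pd i (fun v => Ω₁₁ v a b) u = ξ₁ i u a * ξs₁ i u b)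
    (Ω₁₂ : (Fin N → ℝ) → Matrix (Fin M₁) (Fin M₂) ℝ)
    (hΩ₁₂smooth : ∀ (a : Fin M₁) (b : Fin M₂), ContDiffOn ℝ (⊤ : ℕ∞) (fun u => Ω₁₂ u a b) U)
    (hΩ₁₂ : ∀ i : Fin N, ∀ u ∈ U, ∀ (a : Fin M₁) (b : Fin M₂),
      pd i (fun v => Ω₁₂ v a b) u = ξ₁ i u a * ξs₂ i u b)
    (Ω₂₁ : (Fin N → ℝ) → Matrix (Fin M₂) (Fin M₁) ℝ)
    (hΩ₂₁smooth : ∀ (a : Fin M₂) (b : Fin M₁), ContDiffOn ℝ (⊤ : ℕ∞) (fun u => Ω₂₁ u a b) U)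
    (hΩ₂₁ : ∀ i : Fin N, ∀ u ∈ U, ∀ (a : Fin M₂) (b : Fin M₁),
      pd i (fun v => Ω₂₁ v a b) u = ξ₂ i u a * ξs₁ i u b)
    (Ω₂₂ : (Fin N → ℝ) → Matrix (Fin M₂) (Fin M₂) ℝ)
    (hΩ₂₂smooth : ∀ (a b : Fin M₂), ContDiffOn ℝ (⊤ : ℕ∞) (fun u => Ω₂₂ u a b) U)
    (hΩ₂₂ : ∀ i : Fin N, ∀ u ∈ U, ∀ (a b : Fin M₂),
      pd i (fun v => Ω₂₂ v a b) u = ξ₂ i u a * ξs₂ i u b)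
    (hΩ₂₂inv : ∀ u ∈ U, IsUnit (Ω₂₂ u).det) :
    ∀ i : Fin N, ∀ u ∈ U, ∀ (a : Fin M₁) (b : Fin M₁),
      pd i (fun v => (Ω₁₁ v - Ω₁₂ v * (Ω₂₂ v)⁻¹ * Ω₂₁ v) a b) u
        = (ξ₁ i u - (Ω₁₂ u * (Ω₂₂ u)⁻¹) *ᵥ ξ₂ i u) a
          * (ξs₁ i u - ξs₂ i u ᵥ* ((Ω₂₂ u)⁻¹ * Ω₂₁ u)) b := by
  intro i u hu a b
  have smooth {f : (Fin N → ℝ) → ℝ} (hf : ContDiffOn ℝ (⊤ : ℕ∞) f U) : DifferentiableAt ℝ f u :=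
    (hf.contDiffAt (hUopen.mem_nhds hu)).differentiableAt (by simp)
  have h₁₁ : HasMatrixPd i Ω₁₁ (vecMulVec (ξ₁ i u) (ξs₁ i u)) u :=
    fun a b => ⟨smooth (hΩ₁₁smooth a b), hΩ₁₁ i u hu a b⟩
  have h₁₂ : HasMatrixPd i Ω₁₂ (vecMulVec (ξ₁ i u) (ξs₂ i u)) u :=
    fun a b => ⟨smooth (hΩ₁₂smooth a b), hΩ₁₂ i u hu a b⟩
  have h₂₁ : HasMatrixPd i Ω₂₁ (vecMulVec (ξ₂ i u) (ξs₁ i u)) u :=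
    fun a b => ⟨smooth (hΩ₂₁smooth a b), hΩ₂₁ i u hu a b⟩
  have h₂₂ : HasMatrixPd i Ω₂₂ (vecMulVec (ξ₂ i u) (ξs₂ i u)) u :=
    fun a b => ⟨smooth (hΩ₂₂smooth a b), hΩ₂₂ i u hu a b⟩
  rw [((h₁₁.sub ((h₁₂.mul (h₂₂.inv (hΩ₂₂inv u hu))).mul h₂₁)) a b).2, schur_vecMulVec,
    vecMulVec_apply]
end

section
/- Let β_ij : U → ℝ (i ≠ j) satisfy the Darboux equations ∂_k β_ij = β_ik β_kj (pairwise distinct i,j,k) on a nonempty open connected U ⊆ ℝ^N, let ξ_i : U → ℝ^M be an X-solution for β, and suppose the family ξ*_i := (∂_i ξ_i + Σ_{k≠i} ξ_k β_ki)ᵀ is an H-solution for β. Then for every u ∈ U and every pair i ≠ j with ξ_i(u) ≠ 0, the second Lamé equation holds at u: ∂_i β_ij(u) + ∂_j β_ji(u) + Σ_{k≠i,j} β_ki(u) β_kj(u) = 0. -/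
open Matrix Finset

/-- The row-vector family `ξ*_i := (∂_i ξ_i + Σ_{k≠i} ξ_k β_ki)ᵀ` associated to an X-solution
`ξ` of the orthogonal (Lamé) reduction. -/
noncomputable def starSol {N M : ℕ} (β : Fin N → Fin N → (Fin N → ℝ) → ℝ)
    (ξ : Fin N → (Fin N → ℝ) → Fin M → ℝ) (i : Fin N) (u : Fin N → ℝ) : Fin M → ℝ :=
  fun b => pd i (fun v => ξ i v b) u + ∑ k ∈ Finset.univ.erase i, ξ k u b * β k i u

open Filter Topology

theorem pd_congr {N : ℕ} {f g : (Fin N → ℝ) → ℝ} {u : Fin N → ℝ} (h : f =ᶠ[𝓝 u] g)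
    (i : Fin N) : pd i f u = pd i g u := by
  simp only [pd, h.fderiv_eq]

theorem pd_add {N : ℕ} {f g : (Fin N → ℝ) → ℝ} {u : Fin N → ℝ} (hf : DifferentiableAt ℝ f u)
    (hg : DifferentiableAt ℝ g u) (i : Fin N) :
    pd i (fun v => f v + g v) u = pd i f u + pd i g u := by
  simp [pd, fderiv_fun_add hf hg]

theorem pd_mul {N : ℕ} {f g : (Fin N → ℝ) → ℝ} {u : Fin N → ℝ} (hf : DifferentiableAt ℝ f u)
    (hg : DifferentiableAt ℝ g u) (i : Fin N) :
    pd i (fun v => f v * g v) u = f u * pd i g u + pd i f u * g u := by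
  simp [pd, fderiv_fun_mul hf hg, mul_comm]

theorem pd_sum {N : ℕ} {ι : Type*} {s : Finset ι} {f : ι → (Fin N → ℝ) → ℝ} {u : Fin N → ℝ}
    (hf : ∀ k ∈ s, DifferentiableAt ℝ (f k) u) (i : Fin N) :
    pd i (fun v => ∑ k ∈ s, f k v) u = ∑ k ∈ s, pd i (f k) u := by
  simp [pd, fderiv_fun_sum hf]

theorem differentiableAt_pd {N : ℕ} {f : (Fin N → ℝ) → ℝ} {u : Fin N → ℝ}
    (hf : ContDiffAt ℝ 2 f u) (j : Fin N) : DifferentiableAt ℝ (pd j f) u :=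
  ((hf.fderiv_right (m := 1) (by norm_num)).differentiableAt (by norm_num)).clm_apply
    (differentiableAt_const _)

/-- Partial derivatives of a twice continuously differentiable function commute. -/
theorem pd_comm {N : ℕ} {f : (Fin N → ℝ) → ℝ} {u : Fin N → ℝ}
    (hf : ContDiffAt ℝ 2 f u) (i j : Fin N) : pd i (pd j f) u = pd j (pd i f) u := by
  have hd : DifferentiableAt ℝ (fderiv ℝ f) u :=
    (hf.fderiv_right (m := 1) (by norm_num)).differentiableAt (by norm_num)
  have pd_pd (a b : Fin N) :
      pd a (pd b f) u = fderiv ℝ (fderiv ℝ f) u (Pi.single a 1) (Pi.single b 1) := by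
    change fderiv ℝ (fun v => fderiv ℝ f v (Pi.single b 1)) u (Pi.single a 1) = _
    simp [fderiv_clm_apply hd (differentiableAt_const _)]
  rw [pd_pd, pd_pd]
  exact hf.isSymmSndFDerivAt (by simp) _ _

/-- If `β` satisfies the Darboux equations, `ξ` is an X-solution and the family
`ξ*_i := (∂_i ξ_i + Σ_{k≠i} ξ_k β_ki)ᵀ` is an H-solution, then the second Lamé equation holds
at every point where `ξ_i(u) ≠ 0`. -/
theorem stmt_13 {N M : ℕ} (hN : 2 ≤ N)
    (U : Set (Fin N → ℝ)) (hUopen : IsOpen U) (hUconn : IsConnected U)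
    (β : Fin N → Fin N → (Fin N → ℝ) → ℝ)
    (hβsmooth : ∀ i j : Fin N, i ≠ j → ContDiffOn ℝ (⊤ : ℕ∞) (β i j) U)
    (hDarboux : ∀ i j k : Fin N, i ≠ j → j ≠ k → i ≠ k → ∀ u ∈ U,
      pd k (β i j) u = β i k u * β k j u)
    (ξ : Fin N → (Fin N → ℝ) → Fin M → ℝ)
    (hξsmooth : ∀ (j : Fin N) (a : Fin M), ContDiffOn ℝ (⊤ : ℕ∞) (fun u => ξ j u a) U)
    (hξX : ∀ i j : Fin N, i ≠ j → ∀ u ∈ U, ∀ a : Fin M,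
      pd i (fun v => ξ j v a) u = β j i u * ξ i u a)
    (hξsH : ∀ i j : Fin N, i ≠ j → ∀ u ∈ U, ∀ b : Fin M,
      pd i (fun v => starSol β ξ j v b) u = β i j u * starSol β ξ i u b) :
    ∀ u ∈ U, ∀ i j : Fin N, i ≠ j → ξ i u ≠ 0 →
      pd i (β i j) u + pd j (β j i) u
        + ∑ k ∈ (Finset.univ.erase i).erase j, β k i u * β k j u = 0 := by
  intro u hu i j hij hξ
  obtain ⟨a, ha⟩ := Function.ne_iff.mp hξ
  have hU : U ∈ 𝓝 u := hUopen.mem_nhds hu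
  have hξc (k : Fin N) : ContDiffAt ℝ 2 (fun v => ξ k v a) u :=
    ((hξsmooth k a).contDiffAt hU).of_le (WithTop.coe_le_coe.mpr (le_top : (2 : ℕ∞) ≤ ⊤))
  have hξd (k : Fin N) : DifferentiableAt ℝ (fun v => ξ k v a) u :=
    (hξc k).differentiableAt (by norm_num)
  have hβd (k l : Fin N) (hkl : k ≠ l) : DifferentiableAt ℝ (β k l) u :=
    ((hβsmooth k l hkl).contDiffAt hU).differentiableAt (by simp)
  have hmixed : pd i (pd j fun v => ξ j v a) u =
      β j i u * (β i j u * ξ j u a) + pd j (β j i) u * ξ i u a := by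
    rw [pd_comm (hξc j),
      pd_congr (g := fun v => β j i v * ξ i v a)
        (by filter_upwards [hU] with v hv using hξX i j hij v hv a),
      pd_mul (hβd j i hij.symm) (hξd i), hξX j i hij.symm u hu a]
  have hterm : ∀ k ∈ univ.erase j, DifferentiableAt ℝ (fun v => ξ k v a * β k j v) u :=
    fun k hk => (hξd k).mul (hβd k j (ne_of_mem_erase hk))
  have hstar := hξsH i j hij u hu a
  simp only [starSol] at hstar
  rw [pd_add (differentiableAt_pd (hξc j) j) (DifferentiableAt.fun_sum hterm),
    pd_sum hterm, hmixed,
    ← add_sum_erase (univ.erase j) _ (mem_erase.mpr ⟨hij, mem_univ i⟩),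
    ← add_sum_erase (univ.erase i) _ (mem_erase.mpr ⟨hij.symm, mem_univ j⟩),
    pd_mul (hξd i) (hβd i j hij), erase_right_comm (a := j)] at hstar
  have hrest : ∑ k ∈ (univ.erase i).erase j, pd i (fun v => ξ k v a * β k j v) u =
      ξ i u a * ∑ k ∈ (univ.erase i).erase j, β k i u * β k j u +
        β i j u * ∑ k ∈ (univ.erase i).erase j, ξ k u a * β k i u := by
    rw [mul_sum, mul_sum, ← sum_add_distrib]
    refine sum_congr rfl fun k hk => ?_
    simp only [mem_erase, mem_univ, and_true] at hk
    rw [pd_mul (hξd k) (hβd k j hk.1), hξX i k hk.2.symm u hu a,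
      hDarboux k j i hk.1 hij.symm hk.2 u hu]
    ring
  rw [hrest] at hstar
  refine (mul_eq_zero.mp ?_).resolve_left ha
  linear_combination hstar
end
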